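/- arXiv:2203.04548 — 4 statements merged into one kernel-verified Lean document; each statement's English description precedes it below -/
import Mathlib

section
/- Let R, B : [0,1] → ℝ be continuous curves with R(0) < B(0). If some traversal (f,g) of (R,B) maintains positive separation, then for every s ∈ [0,1] one has R(s) < max B and B(s) > min R (where max B is the maximum of B on [0,1] and min R is the minimum of R on [0,1]). -/
/-- A reparametrization: a continuous, nondecreasing, surjective map of `[0,1]` onto `[0,1]`. -/
def Reparam (f : ℝ → ℝ) : Prop :=
  ContinuousOn f (Set.Icc 0 1) ∧ MonotoneOn f (Set.Icc 0 1) ∧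
    Set.MapsTo f (Set.Icc 0 1) (Set.Icc 0 1) ∧ Set.SurjOn f (Set.Icc 0 1) (Set.Icc 0 1)

theorem Reparam.map_zero {f : ℝ → ℝ} (hf : Reparam f) : f 0 = 0 := by
  obtain ⟨-, hmono, hmaps, hsurj⟩ := hf
  have h0 : (0 : ℝ) ∈ Set.Icc (0 : ℝ) 1 := by simp
  obtain ⟨t, ht, hft⟩ := hsurj h0
  exact le_antisymm ((hmono h0 ht ht.1).trans_eq hft) (hmaps h0).1

/-- A traversal with positive separation that starts with `R` below `B` keeps `R` below `B`. -/
theorem Reparam.lt_of_forall_ne {R B f g : ℝ → ℝ}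
    (hR : ContinuousOn R (Set.Icc 0 1)) (hB : ContinuousOn B (Set.Icc 0 1))
    (h0 : R 0 < B 0) (hf : Reparam f) (hg : Reparam g)
    (hsep : ∀ t ∈ Set.Icc (0 : ℝ) 1, R (f t) ≠ B (g t)) :
    ∀ t ∈ Set.Icc (0 : ℝ) 1, R (f t) < B (g t) := by
  intro t ht
  by_contra! hle
  have hstart : R (f 0) ≤ B (g 0) := by
    rw [hf.map_zero, hg.map_zero]
    exact h0.le
  obtain ⟨x, hx, hxe⟩ := isPreconnected_Icc.intermediate_value₂ (by simp) ht
    (hR.comp hf.1 hf.2.2.1) (hB.comp hg.1 hg.2.2.1) hstart hle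
  exact hsep x hx hxe

/-- If `R, B : [0,1] → ℝ` are continuous with `R 0 < B 0` and some traversal `(f, g)` of
`(R, B)` maintains positive separation, then for every `s ∈ [0,1]`, `R s < max B` and
`B s > min R`. -/
theorem stmt0 (R B : ℝ → ℝ)
    (hR : ContinuousOn R (Set.Icc 0 1)) (hB : ContinuousOn B (Set.Icc 0 1))
    (h0 : R 0 < B 0)
    (f g : ℝ → ℝ) (hf : Reparam f) (hg : Reparam g)
    (hsep : ∀ t ∈ Set.Icc (0:ℝ) 1, R (f t) ≠ B (g t)) :
    ∀ s ∈ Set.Icc (0:ℝ) 1,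
      R s < sSup (B '' Set.Icc 0 1) ∧ sInf (R '' Set.Icc 0 1) < B s := by
  have hlt := Reparam.lt_of_forall_ne hR hB h0 hf hg hsep
  intro s hs
  constructor
  · obtain ⟨t, ht, rfl⟩ := hf.2.2.2 hs
    exact (hlt t ht).trans_le
      (le_csSup (isCompact_Icc.image_of_continuousOn hB).bddAbove ⟨g t, hg.2.2.1 ht, rfl⟩)
  · obtain ⟨t, ht, rfl⟩ := hg.2.2.2 hs
    exact (csInf_le (isCompact_Icc.image_of_continuousOn hR).bddBelow
      ⟨f t, hf.2.2.1 ht, rfl⟩).trans_lt (hlt t ht)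
end

section
/- Let E be a real normed vector space, let a, b, c, d ∈ E, and let δ be a real number. Define the segment parametrizations P(s) = (1−s)·a + s·b and Q(t) = (1−t)·c + t·d. Then the set {(s,t) ∈ [0,1] × [0,1] : ‖P(s) − Q(t)‖ ≤ δ} is a convex subset of ℝ². (In particular, in each cell of the free-space diagram of two polygonal curves, the set of forbidden points for the flipped Fréchet measure is convex.) -/
/-- In each cell of the free-space diagram of two polygonal curves, the set of forbidden
points for the flipped Fréchet measure is convex: for segments `P s = (1−s)·a + s·b` and
`Q t = (1−t)·c + t·d` in a real normed vector space, the set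
`{(s,t) ∈ [0,1]² : ‖P s − Q t‖ ≤ δ}` is convex. -/
theorem stmt4 (E : Type*) [NormedAddCommGroup E] [NormedSpace ℝ E]
    (a b c d : E) (δ : ℝ) :
    Convex ℝ {p : ℝ × ℝ | p.1 ∈ Set.Icc (0:ℝ) 1 ∧ p.2 ∈ Set.Icc (0:ℝ) 1 ∧
      ‖((1 - p.1) • a + p.1 • b) - ((1 - p.2) • c + p.2 • d)‖ ≤ δ} := by
  rintro ⟨s, t⟩ ⟨hs, ht, hst⟩ ⟨s', t'⟩ ⟨hs', ht', hst'⟩ u v hu hv huv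
  refine ⟨convex_Icc 0 1 hs hs' hu hv huv, convex_Icc 0 1 ht ht' hu hv huv, ?_⟩
  have h := convex_closedBall (0 : E) δ (mem_closedBall_zero_iff.2 hst)
    (mem_closedBall_zero_iff.2 hst') hu hv huv
  rw [mem_closedBall_zero_iff] at h
  convert h using 1
  congr 1
  obtain rfl : v = 1 - u := by linarith
  simp only [Prod.smul_mk, Prod.mk_add_mk, smul_eq_mul]
  module
end

section
/- Let D ≥ 1 be an integer and let u, v ∈ {0,1}^D be bit vectors. Define sequences of real numbers A_u = (A_u[1],…,A_u[D]) and B_v = (B_v[1],…,B_v[D]) by A_u[k] = −(2−u(k))/3 for odd k and A_u[k] = (2−u(k))/3 for even k, and B_v[k] = (2−v(k))/3 for odd k and B_v[k] = −(2−v(k))/3 for even k. Then dFF(A_u,B_v) ≥ 1 if and only if u and v are orthogonal, i.e., u(k)·v(k) = 0 for every k ∈ {1,…,D}. -/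
/-- A traversal of two sequences of lengths `n` and `m` (with `1`-based indexing):
a list of index pairs starting at `(1,1)`, ending at `(n,m)`, where each pair is obtained
from the previous one by incrementing the first index, the second index, or both. -/
def IsTraversal (n m : ℕ) (τ : List (ℕ × ℕ)) : Prop :=
  τ.head? = some (1, 1) ∧ τ.getLast? = some (n, m) ∧
    τ.Chain' (fun p q => q = (p.1 + 1, p.2) ∨ q = (p.1, p.2 + 1) ∨ q = (p.1 + 1, p.2 + 1))

/-- The discrete flipped Fréchet measure of the sequences `P 1, …, P n` and `Q 1, …, Q m`:
the maximum over all traversals of the minimum distance along the traversal. -/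
noncomputable def dFF {X : Type*} [MetricSpace X] (n m : ℕ) (P Q : ℕ → X) : ℝ :=
  sSup {x : ℝ | ∃ τ : List (ℕ × ℕ), IsTraversal n m τ ∧
    x = sInf ((fun p : ℕ × ℕ => dist (P p.1) (Q p.2)) '' {p | p ∈ τ})}

/-- The vector gadget `A_u` of the 1D lower-bound construction:
`A_u[k] = −(2−u(k))/3` for odd `k` and `A_u[k] = (2−u(k))/3` for even `k`. -/
noncomputable def gadgetA (u : ℕ → ℕ) : ℕ → ℝ := fun k =>
  if Odd k then -((2 - (u k : ℝ)) / 3) else (2 - (u k : ℝ)) / 3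

/-- The vector gadget `B_v` of the 1D lower-bound construction:
`B_v[k] = (2−v(k))/3` for odd `k` and `B_v[k] = −(2−v(k))/3` for even `k`. -/
noncomputable def gadgetB (v : ℕ → ℕ) : ℕ → ℝ := fun k =>
  if Odd k then (2 - (v k : ℝ)) / 3 else -((2 - (v k : ℝ)) / 3)

theorem IsTraversal.one_one_mem {n m : ℕ} {τ : List (ℕ × ℕ)} (h : IsTraversal n m τ) :
    (1, 1) ∈ τ :=
  List.mem_of_head? h.1

/-- Indices only increase along a list of admissible steps. -/
theorem le_getLast_of_isChain_step {n m : ℕ} (l : List (ℕ × ℕ)) :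
    ∀ x : ℕ × ℕ, (x :: l).getLast? = some (n, m) →
      (x :: l).IsChain
        (fun p q => q = (p.1 + 1, p.2) ∨ q = (p.1, p.2 + 1) ∨ q = (p.1 + 1, p.2 + 1)) →
      x.1 ≤ n ∧ x.2 ≤ m := by
  induction l with
  | nil =>
    intro x hx _
    simp only [List.getLast?_singleton, Option.some.injEq] at hx
    simp [hx]
  | cons y t ih =>
    intro x hx hc
    rw [List.isChain_cons_cons] at hc
    rw [List.getLast?_cons_cons] at hx
    have := ih y hx hc.2
    rcases hc.1 with h | h | h <;> subst h <;> simp only at this <;> omega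

/-- Admissible steps from `(a, a)` to `(D, D)` either visit every diagonal pair or visit
a pair of indices of different parity. -/
theorem diag_mem_or_exists_odd_add {D : ℕ} (l : List (ℕ × ℕ)) :
    ∀ a k : ℕ, ((a, a) :: l).getLast? = some (D, D) →
      ((a, a) :: l).IsChain
        (fun p q => q = (p.1 + 1, p.2) ∨ q = (p.1, p.2 + 1) ∨ q = (p.1 + 1, p.2 + 1)) →
      a ≤ k → k ≤ D →
      (k, k) ∈ (a, a) :: l ∨
        ∃ p ∈ (a, a) :: l, p.1 ∈ Set.Icc a D ∧ p.2 ∈ Set.Icc a D ∧ Odd (p.1 + p.2) := by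
  induction l with
  | nil =>
    intro a k hl _ hak hkD
    simp only [List.getLast?_singleton, Option.some.injEq, Prod.mk.injEq] at hl
    left
    simp only [List.mem_singleton, Prod.mk.injEq]
    omega
  | cons y t ih =>
    intro a k hl hc hak hkD
    rw [List.isChain_cons_cons] at hc
    rw [List.getLast?_cons_cons] at hl
    have hle := le_getLast_of_isChain_step t y hl hc.2
    rcases hc.1 with h | h | h <;> subst h <;> simp only at hle
    · exact .inr ⟨(a + 1, a), by simp, ⟨by simp, hle.1⟩, ⟨le_rfl, hle.2⟩, a, by simp only; ring⟩
    · exact .inr ⟨(a, a + 1), by simp, ⟨le_rfl, hle.1⟩, ⟨by simp, hle.2⟩, a, by simp only; ring⟩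
    · rcases hak.eq_or_lt with rfl | hak
      · simp
      · rcases ih (a + 1) k hl hc.2 hak hkD with h | ⟨p, hp, h₁, h₂, h₃⟩
        · exact .inl (List.mem_cons_of_mem _ h)
        · exact .inr ⟨p, List.mem_cons_of_mem _ hp, ⟨by have := h₁.1; omega, h₁.2⟩,
            ⟨by have := h₂.1; omega, h₂.2⟩, h₃⟩

theorem isTraversal_diag {D : ℕ} (hD : 1 ≤ D) :
    IsTraversal D D ((List.range' 1 D).map fun k => (k, k)) := by
  refine ⟨?_, ?_, ?_⟩
  · simp [List.head?_range']; omega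
  · simp [List.getLast?_range']; omega
  · change List.IsChain _ _
    rw [List.isChain_map]
    refine (List.isChain_range' 1 D 1).imp fun a b h => ?_
    simp [h]

section dFF

variable {X : Type*} [MetricSpace X] {n m : ℕ} {P Q : ℕ → X} {τ : List (ℕ × ℕ)}

theorem bddBelow_dist_image (P Q : ℕ → X) (s : Set (ℕ × ℕ)) :
    BddBelow ((fun p : ℕ × ℕ => dist (P p.1) (Q p.2)) '' s) :=
  ⟨0, by rintro _ ⟨p, -, rfl⟩; exact dist_nonneg⟩

theorem dFF_le {c : ℝ} (hc : 0 ≤ c)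
    (h : ∀ τ, IsTraversal n m τ → ∃ p ∈ τ, dist (P p.1) (Q p.2) ≤ c) : dFF n m P Q ≤ c := by
  refine Real.sSup_le ?_ hc
  rintro _ ⟨τ, hτ, rfl⟩
  obtain ⟨p, hp, hpc⟩ := h τ hτ
  exact (csInf_le (bddBelow_dist_image P Q _) ⟨p, hp, rfl⟩).trans hpc

theorem le_dFF {c : ℝ} (hτ : IsTraversal n m τ)
    (h : ∀ p ∈ τ, c ≤ dist (P p.1) (Q p.2)) : c ≤ dFF n m P Q := by
  have hbdd : BddAbove {x : ℝ | ∃ τ : List (ℕ × ℕ), IsTraversal n m τ ∧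
      x = sInf ((fun p : ℕ × ℕ => dist (P p.1) (Q p.2)) '' {p | p ∈ τ})} := by
    refine ⟨dist (P 1) (Q 1), ?_⟩
    rintro _ ⟨σ, hσ, rfl⟩
    exact csInf_le (bddBelow_dist_image P Q _) ⟨(1, 1), hσ.one_one_mem, rfl⟩
  refine le_csSup_of_le hbdd ⟨τ, hτ, rfl⟩ (le_csInf ⟨_, (1, 1), hτ.one_one_mem, rfl⟩ ?_)
  rintro _ ⟨p, hp, rfl⟩
  exact h p hp

end dFF

theorem dist_gadget_self {u v : ℕ → ℕ} {k : ℕ} (hu : u k ≤ 1) (hv : v k ≤ 1) :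
    dist (gadgetA u k) (gadgetB v k) = (4 - (u k : ℝ) - v k) / 3 := by
  have hu' : (u k : ℝ) ≤ 1 := by exact_mod_cast hu
  have hv' : (v k : ℝ) ≤ 1 := by exact_mod_cast hv
  unfold gadgetA gadgetB
  rw [Real.dist_eq]
  split_ifs
  · rw [abs_of_nonpos] <;> linarith
  · rw [abs_of_nonneg] <;> linarith

theorem dist_gadget_le_of_odd_add {u v : ℕ → ℕ} {i j : ℕ} (hu : u i ≤ 1) (hv : v j ≤ 1)
    (hij : Odd (i + j)) : dist (gadgetA u i) (gadgetB v j) ≤ 1 / 3 := by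
  have hu' : (u i : ℝ) ≤ 1 := by exact_mod_cast hu
  have hv' : (v j : ℝ) ≤ 1 := by exact_mod_cast hv
  have hu₀ : (0 : ℝ) ≤ u i := Nat.cast_nonneg _
  have hv₀ : (0 : ℝ) ≤ v j := Nat.cast_nonneg _
  rw [Nat.odd_add, ← Nat.not_odd_iff_even] at hij
  unfold gadgetA gadgetB
  rw [Real.dist_eq, abs_le]
  by_cases hi : Odd i
  · rw [if_pos hi, if_neg (hij.1 hi)]
    constructor <;> linarith
  · rw [if_neg hi, if_pos (not_not.1 fun hj => hi (hij.2 hj))]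
    constructor <;> linarith

/-- For bit vectors `u, v ∈ {0,1}^D`, the gadgets `A_u` and `B_v` satisfy
`dFF(A_u, B_v) ≥ 1` if and only if `u` and `v` are orthogonal. -/
theorem stmt9 (D : ℕ) (hD : 1 ≤ D) (u v : ℕ → ℕ)
    (hu : ∀ k ∈ Set.Icc 1 D, u k ≤ 1) (hv : ∀ k ∈ Set.Icc 1 D, v k ≤ 1) :
    1 ≤ dFF D D (gadgetA u) (gadgetB v) ↔ ∀ k ∈ Set.Icc 1 D, u k * v k = 0 := by
  constructor
  · intro h k hk
    by_contra hne
    have huk : u k = 1 := by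
      have := hu k hk
      have : u k ≠ 0 := left_ne_zero_of_mul hne
      omega
    have hvk : v k = 1 := by
      have := hv k hk
      have : v k ≠ 0 := right_ne_zero_of_mul hne
      omega
    have hle : dFF D D (gadgetA u) (gadgetB v) ≤ 2 / 3 := by
      refine dFF_le (by norm_num) fun τ ⟨hhead, hlast, hchain⟩ => ?_
      obtain ⟨l, rfl⟩ := List.head?_eq_some_iff.1 hhead
      rcases diag_mem_or_exists_odd_add l 1 k hlast hchain hk.1 hk.2 with hkk | ⟨p, hp, h₁, h₂, h₃⟩
      · refine ⟨(k, k), hkk, ?_⟩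
        rw [dist_gadget_self (hu k hk) (hv k hk), huk, hvk]
        norm_num
      · exact ⟨p, hp, (dist_gadget_le_of_odd_add (hu _ h₁) (hv _ h₂) h₃).trans (by norm_num)⟩
    linarith
  · intro h
    refine le_dFF (isTraversal_diag hD) fun p hp => ?_
    obtain ⟨k, hk, rfl⟩ := List.mem_map.1 hp
    rw [List.mem_range'_1] at hk
    have hk : k ∈ Set.Icc 1 D := ⟨hk.1, by omega⟩
    have huv : u k + v k ≤ 1 := by
      have := hu k hk
      have := hv k hk
      rcases mul_eq_zero.1 (h k hk) with h₀ | h₀ <;> omega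
    have huv' : (u k : ℝ) + v k ≤ 1 := by exact_mod_cast huv
    rw [dist_gadget_self (hu k hk) (hv k hk)]
    linarith
end

section
/- In a finite tree T, the intersection of all diameter paths is a path: there exists a path π in T whose vertex set equals the set of vertices that lie on every diameter path of T; in particular this set of common vertices is nonempty. -/
namespace SimpleGraph

variable {V : Type*} {G : SimpleGraph V} {a b m w x : V}

lemma IsAcyclic.length_eq_dist_of_isPath (hG : G.IsAcyclic) {p : G.Walk a b} (hp : p.IsPath) :
    p.length = G.dist a b := by
  obtain ⟨q, hq, hlen⟩ := p.reachable.exists_path_of_dist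
  rw [← hlen, Subtype.mk.inj (hG.subsingleton_path a b |>.elim ⟨p, hp⟩ ⟨q, hq⟩)]

/-- In a tree, a path consists of the vertices lying metrically between its ends. -/
lemma IsTree.mem_support_iff_dist_add_dist (hG : G.IsTree) {p : G.Walk a b} (hp : p.IsPath) :
    w ∈ p.support ↔ G.dist a w + G.dist w b = G.dist a b := by
  constructor
  · intro hw
    obtain ⟨q, r, hq, hr, rfl⟩ := hp.mem_support_iff_exists_append.mp hw
    rw [← hG.isAcyclic.length_eq_dist_of_isPath hp, ← hG.isAcyclic.length_eq_dist_of_isPath hq,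
      ← hG.isAcyclic.length_eq_dist_of_isPath hr, Walk.length_append]
  · intro h
    obtain ⟨q, hq⟩ := hG.connected.exists_walk_length_eq_dist a w
    obtain ⟨r, hr⟩ := hG.connected.exists_walk_length_eq_dist w b
    have hqr : (q.append r).IsPath :=
      Walk.isPath_of_length_eq_dist _ (by rw [Walk.length_append, hq, hr, h])
    rw [Subtype.mk.inj (hG.isAcyclic.subsingleton_path a b |>.elim ⟨p, hp⟩ ⟨_, hqr⟩)]
    simp [Walk.mem_support_append_iff]

/-- On a path of a tree, the distance of two vertices is the difference of their distances to
the start of the path. -/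
lemma IsTree.dist_add_dist_of_mem_support (hG : G.IsTree) {p : G.Walk a b} (hp : p.IsPath)
    (hw : w ∈ p.support) (hx : x ∈ p.support) :
    G.dist a w + G.dist w x = G.dist a x ∨ G.dist a x + G.dist w x = G.dist a w := by
  have hwD := (hG.mem_support_iff_dist_add_dist hp).mp hw
  have hxD := (hG.mem_support_iff_dist_add_dist hp).mp hx
  obtain ⟨q, r, hq, hr, rfl⟩ := hp.mem_support_iff_exists_append.mp hx
  rcases (Walk.mem_support_append_iff _ _).mp hw with h | h
  · exact .inl ((hG.mem_support_iff_dist_add_dist hq).mp h)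
  · have := (hG.mem_support_iff_dist_add_dist hr).mp h
    have := G.dist_comm (u := x) (v := w)
    right
    lia

/-- In a tree, a nearest vertex `m` of a path to `x` lies between `x` and any path vertex `w`. -/
lemma IsTree.dist_eq_dist_add_dist_of_forall_le (hG : G.IsTree) {p : G.Walk a b} (hp : p.IsPath)
    (hm : m ∈ p.support) (hmin : ∀ z ∈ p.support, G.dist x m ≤ G.dist x z)
    (hw : w ∈ p.support) : G.dist x w = G.dist x m + G.dist m w := by
  obtain ⟨q, hq, -⟩ := hG.connected.exists_path_of_dist x m
  obtain ⟨r, hr, -⟩ := hG.connected.exists_path_of_dist m w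
  have hrp : ∀ z ∈ r.support, z ∈ p.support := by
    intro z hz
    have hz := (hG.mem_support_iff_dist_add_dist hr).mp hz
    have hwD := (hG.mem_support_iff_dist_add_dist hp).mp hw
    have hmD := (hG.mem_support_iff_dist_add_dist hp).mp hm
    have := hG.dist_add_dist_of_mem_support hp hw hm
    have := G.dist_comm (u := m) (v := w)
    have := G.dist_comm (u := z) (v := w)
    have := G.dist_comm (u := z) (v := m)
    have := hG.connected.dist_triangle (u := a) (v := m) (w := z)
    have := hG.connected.dist_triangle (u := a) (v := w) (w := z)
    have := hG.connected.dist_triangle (u := z) (v := m) (w := b)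
    have := hG.connected.dist_triangle (u := z) (v := w) (w := b)
    have := hG.connected.dist_triangle (u := a) (v := z) (w := b)
    rw [hG.mem_support_iff_dist_add_dist hp]
    lia
  have hqr : (q.append r).IsPath := by
    rw [Walk.isPath_def, Walk.support_append, List.nodup_append']
    refine ⟨hq.support_nodup, hr.support_nodup.tail, fun z hzq hzr ↦ ?_⟩
    have hzD := (hG.mem_support_iff_dist_add_dist hq).mp hzq
    have hle := hmin z (hrp z (List.mem_of_mem_tail hzr))
    obtain rfl : z = m := hG.connected.dist_eq_zero_iff.mp (by lia)
    have hnd := hr.support_nodup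
    rw [← Walk.cons_tail_support] at hnd
    exact (List.nodup_cons.mp hnd).1 hzr
  rw [← hG.isAcyclic.length_eq_dist_of_isPath hqr, Walk.length_append,
    hG.isAcyclic.length_eq_dist_of_isPath hq, hG.isAcyclic.length_eq_dist_of_isPath hr]

/-- In a tree, any vertex `x` has a gate on a path: a path vertex `m` lying between `x` and every
vertex of the path. -/
lemma IsTree.exists_mem_support_forall_dist_eq (hG : G.IsTree) {p : G.Walk a b} (hp : p.IsPath)
    (x : V) : ∃ m ∈ p.support, ∀ w ∈ p.support, G.dist x w = G.dist x m + G.dist m w := by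
  obtain ⟨m, hm, hmin⟩ := Set.exists_min_image {z | z ∈ p.support} (G.dist x)
    (List.finite_toSet _) ⟨a, p.start_mem_support⟩
  exact ⟨m, hm, fun w hw ↦ hG.dist_eq_dist_add_dist_of_forall_le hp hm hmin hw⟩

/-- Every vertex is within half the length of a longest path from the middle of that path. -/
lemma IsTree.dist_getVert_half_le (hG : G.IsTree) {p : G.Walk a b} (hp : p.IsPath)
    (hmax : ∀ (c d : V) (q : G.Walk c d), q.IsPath → q.length ≤ p.length) (x : V) :
    G.dist x (p.getVert (p.length / 2)) ≤ (p.length + 1) / 2 := by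
  have hdiam : ∀ u v, G.dist u v ≤ p.length := fun u v ↦ by
    obtain ⟨q, hq, hlen⟩ := hG.connected.exists_path_of_dist u v
    exact hlen ▸ hmax u v q hq
  set c := p.getVert (p.length / 2)
  have hcp : c ∈ p.support := p.getVert_mem_support _
  have hac : G.dist a c = p.length / 2 := by
    rw [← hG.isAcyclic.length_eq_dist_of_isPath (hp.take (p.length / 2)), Walk.take_length]
    lia
  have hlen := hG.isAcyclic.length_eq_dist_of_isPath hp
  obtain ⟨m, hm, hgate⟩ := hG.exists_mem_support_forall_dist_eq hp x
  have hmD := (hG.mem_support_iff_dist_add_dist hp).mp hm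
  have := hG.dist_add_dist_of_mem_support hp hm hcp
  have := hgate a p.start_mem_support
  have := hgate b p.end_mem_support
  have := hgate c hcp
  have := hdiam x a
  have := hdiam x b
  have := G.dist_comm (u := a) (v := m)
  lia

/-- In a tree, all longest paths pass through the middle of any one of them. -/
lemma IsTree.getVert_half_mem_support (hG : G.IsTree) {p : G.Walk a b} (hp : p.IsPath)
    (hmax : ∀ (c d : V) (q : G.Walk c d), q.IsPath → q.length ≤ p.length)
    {u v : V} {q : G.Walk u v} (hq : q.IsPath)
    (hle : p.length ≤ q.length) : p.getVert (p.length / 2) ∈ q.support := by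
  set c := p.getVert (p.length / 2) with hc
  have hu := hG.dist_getVert_half_le hp hmax u
  have hv := hG.dist_getVert_half_le hp hmax v
  rw [← hc, G.dist_comm] at hu hv
  obtain ⟨m, hm, hgate⟩ := hG.exists_mem_support_forall_dist_eq hq c
  have hmD := (hG.mem_support_iff_dist_add_dist hq).mp hm
  have := hG.isAcyclic.length_eq_dist_of_isPath hq
  have := hgate u q.start_mem_support
  have := hgate v q.end_mem_support
  have := G.dist_comm (u := u) (v := m)
  have hcm : c = m := hG.connected.dist_eq_zero_iff.mp (by lia)
  exact hcm ▸ hm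

/-- On a path of a tree, the vertices between two path vertices belong to the path. -/
lemma IsTree.support_subset_of_mem_support (hG : G.IsTree) {p : G.Walk a b} (hp : p.IsPath)
    (hw : w ∈ p.support) (hx : x ∈ p.support) {q : G.Walk w x} (hq : q.IsPath) :
    q.support ⊆ p.support := by
  intro z hz
  have hz := (hG.mem_support_iff_dist_add_dist hq).mp hz
  have hwD := (hG.mem_support_iff_dist_add_dist hp).mp hw
  have hxD := (hG.mem_support_iff_dist_add_dist hp).mp hx
  have := hG.dist_add_dist_of_mem_support hp hw hx
  have := G.dist_comm (u := z) (v := w)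
  have := G.dist_comm (u := z) (v := x)
  have := hG.connected.dist_triangle (u := a) (v := w) (w := z)
  have := hG.connected.dist_triangle (u := a) (v := x) (w := z)
  have := hG.connected.dist_triangle (u := z) (v := w) (w := b)
  have := hG.connected.dist_triangle (u := z) (v := x) (w := b)
  have := hG.connected.dist_triangle (u := a) (v := z) (w := b)
  rw [hG.mem_support_iff_dist_add_dist hp]
  lia

/-- In a tree, a nonempty set of vertices of a path that contains the path between any two of
its elements is the vertex set of a path. -/
lemma IsTree.exists_isPath_support_eq (hG : G.IsTree) {p : G.Walk a b} (hp : p.IsPath)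
    {s : Set V} (hs : s.Nonempty) (hsp : ∀ z ∈ s, z ∈ p.support)
    (hconv : ∀ w ∈ s, ∀ x ∈ s, ∀ q : G.Walk w x, q.IsPath → ∀ z ∈ q.support, z ∈ s) :
    ∃ (x y : V) (π : G.Walk x y), π.IsPath ∧ {w | w ∈ π.support} = s := by
  have hfin : s.Finite := (List.finite_toSet p.support).subset hsp
  obtain ⟨x, hx, hxmin⟩ := Set.exists_min_image s (G.dist a) hfin hs
  obtain ⟨y, hy, hymax⟩ := Set.exists_max_image s (G.dist a) hfin hs
  obtain ⟨π, hπ, -⟩ := hG.connected.exists_path_of_dist x y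
  refine ⟨x, y, π, hπ, Set.Subset.antisymm (hconv x hx y hy π hπ) fun w hw ↦ ?_⟩
  rw [Set.mem_ofPred_eq, hG.mem_support_iff_dist_add_dist hπ]
  have := hxmin w hw
  have := hymax w hw
  have := hG.dist_add_dist_of_mem_support hp (hsp x hx) (hsp w hw)
  have := hG.dist_add_dist_of_mem_support hp (hsp w hw) (hsp y hy)
  have := hG.dist_add_dist_of_mem_support hp (hsp x hx) (hsp y hy)
  lia

end SimpleGraph

/-- In a finite tree, the intersection of all diameter paths is a path: there is a path `π`
whose vertex set is exactly the set of vertices lying on every diameter path; in particular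
this set of common vertices is nonempty. -/
theorem stmt13 {V : Type*} [Fintype V] (G : SimpleGraph V) (hG : G.IsTree) :
    ∃ (x y : V) (π : G.Walk x y), π.IsPath ∧
      {w : V | w ∈ π.support} =
        {w : V | ∀ (a b : V) (p : G.Walk a b), p.IsPath →
          (∀ (c d : V) (q : G.Walk c d), q.IsPath → q.length ≤ p.length) →
          w ∈ p.support} ∧
      {w : V | ∀ (a b : V) (p : G.Walk a b), p.IsPath →
          (∀ (c d : V) (q : G.Walk c d), q.IsPath → q.length ≤ p.length) →
          w ∈ p.support}.Nonempty := by
  have := hG.connected.nonempty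
  obtain ⟨a, b, p, hp, hmax⟩ := SimpleGraph.Walk.exists_isPath_forall_isPath_length_le_length G
  set s := {w : V | ∀ (a b : V) (p : G.Walk a b), p.IsPath →
    (∀ (c d : V) (q : G.Walk c d), q.IsPath → q.length ≤ p.length) → w ∈ p.support}
  have hs : s.Nonempty := ⟨_, fun u v q hq hqmax ↦
    hG.getVert_half_mem_support hp hmax hq (hqmax a b p hp)⟩
  obtain ⟨x, y, π, hπ, hπs⟩ := hG.exists_isPath_support_eq hp hs
    (fun z hz ↦ hz a b p hp hmax)
    (fun w hw x hx r hr z hz u v q hq hqmax ↦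
      hG.support_subset_of_mem_support hq (hw u v q hq hqmax) (hx u v q hq hqmax) hr hz)
  exact ⟨x, y, π, hπ, hπs, hs⟩
end
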